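/- Let H and K be complex Hilbert spaces with dim H > 1, let 𝒜 ⊆ B(H) and ℬ ⊆ B(K) be standard operator algebras which are closed under taking adjoints, and let φ : 𝒜 → ℬ be a bijective transformation satisfying φ(A*) = φ(A)* and φ(AB+BA) = φ(A)φ(B)+φ(B)φ(A) for all A, B ∈ 𝒜. Then φ preserves positivity in both directions: for every A ∈ 𝒜, A is positive if and only if φ(A) is positive. -/

import Mathlib

set_option linter.unusedSectionVars false
set_option linter.unusedSimpArgs false
namespace JMap

section abs
variable {R S : Type*} [NonUnitalRing R] [NonUnitalRing S]

def J {R : Type*} [NonUnitalRing R] (a b : R) : R := a * b + b * a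

def M11 (e a : R) : Prop := e * a = a ∧ a * e = a
def M12 (e a : R) : Prop := e * a = a ∧ a * e = 0
def M21 (e a : R) : Prop := e * a = 0 ∧ a * e = a
def M22 (e a : R) : Prop := e * a = 0 ∧ a * e = 0

lemma zA (e : R) {a b : R} (h : a * e = a) (h' : e * b = 0) : a * b = 0 := by
  rw [← h, mul_assoc, h', mul_zero]
lemma zB (e : R) {a b : R} (h : a * e = 0) (h' : e * b = b) : a * b = 0 := by
  rw [← h', ← mul_assoc, h, zero_mul]
lemma lm {e a : R} (h : e * a = a) (b : R) : e * (a * b) = a * b := by rw [← mul_assoc, h]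
lemma lz {e a : R} (h : e * a = 0) (b : R) : e * (a * b) = 0 := by rw [← mul_assoc, h, zero_mul]
lemma rm {e b : R} (h : b * e = b) (a : R) : (a * b) * e = a * b := by rw [mul_assoc, h]
lemma rz {e b : R} (h : b * e = 0) (a : R) : (a * b) * e = 0 := by rw [mul_assoc, h, mul_zero]

lemma J_add (a b c : R) : J (a + b) c = J a c + J b c := by simp only [J, add_mul, mul_add]; abel
lemma J_sub (a b c : R) : J (a - b) c = J a c - J b c := by simp only [J, sub_mul, mul_sub]; abel
lemma J_zero (a : R) : J 0 a = 0 := by simp [J]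
lemma J_add' (a b c : R) : J c (a + b) = J c a + J c b := by simp only [J, add_mul, mul_add]; abel

lemma M_zero {e D : R} (h : M11 e D) (h' : M22 e D) : D = 0 := by rw [← h.1, h'.1]

/-- faithfulness hypotheses on the Peirce decomposition -/
structure Faith (e : R) : Prop where
  he : e * e = e
  two : ∀ x : R, x + x = 0 → x = 0
  f22 : ∀ x, M22 e x → (∀ c, M22 e c → J x c = 0) → x = 0
  g12 : ∀ x, x * e = x → (∀ c, M12 e c → x * c = 0) → x = 0
  g12' : ∀ x, e * x = 0 → (∀ c, M12 e c → c * x = 0) → x = 0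
  g21 : ∀ x, e * x = x → (∀ c, M21 e c → c * x = 0) → x = 0
  g21' : ∀ x, x * e = 0 → (∀ c, M21 e c → x * c = 0) → x = 0
  g22 : ∀ x, x * e = 0 → (∀ c, M22 e c → x * c = 0) → x = 0
  g22' : ∀ x, e * x = 0 → (∀ c, M22 e c → c * x = 0) → x = 0

variable {e : R} (F : Faith e)
include F

lemma Ue {D : R} (h : J D e = 0) : M22 e D := by
  have he := F.he
  have h1 : e * D * e = 0 := by
    apply F.two
    have := congrArg (fun z => e * z * e) h
    simpa [J, mul_add, add_mul, mul_assoc, he, lm he] using this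
  have h2 : e * D = 0 := by
    have := congrArg (fun z => e * z) h
    simpa [J, mul_add, ← mul_assoc, he, h1] using this
  exact ⟨h2, by simpa [J, h2] using h⟩

lemma U22 {D : R} (h : ∀ c, M22 e c → J D c = 0) : M11 e D := by
  have he := F.he
  have h1 : e * D - e * D * e = 0 := by
    apply F.g22
    · simp [sub_mul, mul_assoc, he]
    intro c hc
    have := congrArg (fun z => e * z) (h c hc)
    simpa [J, mul_add, sub_mul, mul_assoc, lz hc.1, hc.1] using this
  have h2 : D * e - e * D * e = 0 := by
    apply F.g22'
    · simp [mul_sub, ← mul_assoc, he]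
    intro c hc
    have := congrArg (fun z => z * e) (h c hc)
    have k : c * (e * (D * e)) = 0 := by rw [← mul_assoc, hc.2, zero_mul]
    simpa [J, add_mul, mul_sub, mul_assoc, hc.2, k] using this
  have h3 : D - e * D - D * e + e * D * e = 0 := by
    apply F.f22
    · constructor
      · simp [mul_sub, mul_add, ← mul_assoc, he]
      · simp [sub_mul, add_mul, mul_assoc, he]
    intro c hc
    have k := h c hc
    have k1 : e * D * c = 0 := by
      have := congrArg (fun z => e * z) k
      simpa [J, mul_add, mul_assoc, lz hc.1] using this
    have k2 : c * (D * e) = 0 := by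
      have := congrArg (fun z => z * e) k
      simpa [J, add_mul, mul_assoc, hc.2] using this
    have k3 : c * (e * D) = 0 := by rw [← mul_assoc, hc.2, zero_mul]
    have k4 : (D * e) * c = 0 := by rw [mul_assoc, hc.1, mul_zero]
    have k5 : (e * D * e) * c = 0 := by rw [mul_assoc, hc.1, mul_zero]
    have k6 : c * (e * D * e) = 0 := by rw [mul_assoc, ← mul_assoc, hc.2, zero_mul]
    have : J (D - e * D - D * e + e * D * e) c = J D c := by
      simp only [J, sub_mul, add_mul, mul_sub, mul_add, k1, k2, k3, k4, k5, k6]; abel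
    rw [this, k]
  have h1' := sub_eq_zero.1 h1
  have h2' := sub_eq_zero.1 h2
  have h3' : D = e * D * e := by
    rw [← sub_eq_zero]
    calc D - e * D * e = (D - e * D - D * e + e * D * e) + (e * D - e * D * e)
          + (D * e - e * D * e) := by abel
      _ = 0 := by rw [h1, h2, h3]; simp
  constructor
  · rw [h1', ← h3']
  · rw [h2', ← h3']

lemma U11 {D : R} (hD : M11 e D) (h : ∀ c, M12 e c → J D c = 0) : D = 0 := by
  apply F.g12 _ hD.2
  intro c hc
  have := h c hc
  simpa [J, zB e hc.2 hD.1] using this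

lemma U11' {D : R} (hD : M11 e D) (h : ∀ c, M21 e c → J D c = 0) : D = 0 := by
  apply F.g21 _ hD.1
  intro c hc
  have := h c hc
  simpa [J, zA e hD.2 hc.1] using this

lemma U222 {D : R} (hD : M22 e D) (h : ∀ c, M12 e c → J D c = 0) : D = 0 := by
  apply F.g12' _ hD.1
  intro c hc
  have := h c hc
  simpa [J, zB e hD.2 hc.1] using this

lemma U222' {D : R} (hD : M22 e D) (h : ∀ c, M21 e c → J D c = 0) : D = 0 := by
  apply F.g21' _ hD.2
  intro c hc
  have := h c hc
  simpa [J, zA e hc.2 hD.1] using this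

lemma Uoff {D : R} (h : J D e = D) (h12 : ∀ c, M12 e c → J D c = 0)
    (h21 : ∀ c, M21 e c → J D c = 0) : D = 0 := by
  have he := F.he
  have h1 : e * D * e = 0 := by
    have := congrArg (fun z => e * z * e) h
    simpa [J, mul_add, add_mul, mul_assoc, he, lm he] using this
  have h2 : D * e = 0 := by
    apply F.g12
    · rw [mul_assoc, he]
    intro c hc
    have k := congrArg (fun z => e * z) (h12 c hc)
    have h0 := h12 c hc
    have k1 : e * (D * c) = 0 := by
      rw [← hc.1]; simpa only [mul_assoc, zero_mul] using congrArg (fun z => z * c) h1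
    have k2 : c * D = 0 := by
      simpa [J, mul_add, lm hc.1, k1] using k
    rw [mul_assoc, hc.1]
    simpa [J, k2] using h0
  have h3 : e * D = 0 := by
    apply F.g21
    · rw [← mul_assoc, he]
    intro c hc
    have k := congrArg (fun z => z * e) (h21 c hc)
    have h0 := h21 c hc
    have k1 : c * (D * e) = 0 := by
      rw [h2, mul_zero]
    have k2 : D * c = 0 := by
      simpa [J, add_mul, rm hc.2, mul_assoc, k1, hc.2, h2] using k
    rw [← mul_assoc, hc.2]
    simpa [J, k2] using h0
  simpa [J, h2, h3] using h.symm

variable {φ : R → S} (hb : Function.Bijective φ) (hJ : ∀ a b, φ (J a b) = J (φ a) (φ b))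
include hb hJ

omit F in
lemma phi0 : φ 0 = 0 := by
  obtain ⟨z, hz⟩ := hb.2 0
  have := hJ z 0
  simpa [J, hz] using this

omit F in
lemma key {T a b : R} (h : φ T = φ a + φ b) (c : R) : φ (J T c) = φ (J a c) + φ (J b c) := by
  rw [hJ, hJ, hJ, h, J_add]

omit F hJ in
/-- criterion: `φ(a+b) = φ a + φ b` if every `T` with `φ T = φ a + φ b` equals `a+b`. -/
lemma crit {a b : R} (h : ∀ T, φ T = φ a + φ b → T - (a + b) = 0) : φ (a + b) = φ a + φ b := by
  obtain ⟨T, hT⟩ := hb.2 (φ a + φ b)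
  rw [← hT, sub_eq_zero.1 (h T hT)]

omit F in
/-- if the images are additive after multiplication with `c`, then `J D c = 0`. -/
lemma step {T a b : R} (h : φ T = φ a + φ b) (c : R)
    (h' : φ (J a c + J b c) = φ (J a c) + φ (J b c)) : J (T - (a + b)) c = 0 := by
  rw [J_sub, sub_eq_zero]
  apply hb.1
  rw [key hb hJ h, J_add, h']

omit F in
lemma stepl {T a b : R} (h : φ T = φ a + φ b) (c : R)
    (h' : J a c = 0) : J (T - (a + b)) c = 0 := by
  apply step hb hJ h; simp [h', phi0 hb hJ]

omit F in
lemma stepr {T a b : R} (h : φ T = φ a + φ b) (c : R)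
    (h' : J b c = 0) : J (T - (a + b)) c = 0 := by
  apply step hb hJ h; simp [h', phi0 hb hJ]

omit F hb hJ in
lemma z1122 {a b : R} (ha : M11 e a) (hb : M22 e b) : J a b = 0 := by
  simp [J, zA e ha.2 hb.1, zB e hb.2 ha.1]
omit F hb hJ in
lemma z2211 {a b : R} (ha : M22 e a) (hb : M11 e b) : J a b = 0 := by
  simp [J, zA e hb.2 ha.1, zB e ha.2 hb.1]
omit F hb hJ in
lemma z12 {a b : R} (ha : M12 e a) (hb : M12 e b) : J a b = 0 := by
  simp [J, zB e hb.2 ha.1, zB e ha.2 hb.1]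
omit F hb hJ in
lemma z21 {a b : R} (ha : M21 e a) (hb : M21 e b) : J a b = 0 := by
  simp [J, zA e hb.2 ha.1, zA e ha.2 hb.1]
omit hb hJ in
lemma Me : M11 e e := ⟨F.he, F.he⟩
omit F hb hJ in
lemma Je12 {a : R} (ha : M12 e a) : J a e = a := by simp [J, ha.1, ha.2]
omit F hb hJ in
lemma Je21 {a : R} (ha : M21 e a) : J a e = a := by simp [J, ha.1, ha.2]
omit F hb hJ in
lemma J1222 {a b : R} (ha : M12 e a) (hb : M22 e b) : J a b = a * b ∧ M12 e (a * b) := by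
  refine ⟨by simp [J, zB e hb.2 ha.1], lm ha.1 _, rz hb.2 _⟩
omit F hb hJ in
lemma J2122 {a b : R} (ha : M21 e a) (hb : M22 e b) : J a b = b * a ∧ M21 e (b * a) := by
  refine ⟨by simp [J, zA e ha.2 hb.1], lz hb.1 _, rm ha.2 _⟩
omit F hb hJ in
lemma J1112 {a b : R} (ha : M11 e a) (hb : M12 e b) : J a b = a * b ∧ M12 e (a * b) := by
  refine ⟨by simp [J, zB e hb.2 ha.1], lm ha.1 _, rz hb.2 _⟩
omit F hb hJ in
lemma J2212 {a b : R} (ha : M22 e a) (hb : M12 e b) : J a b = b * a ∧ M12 e (b * a) := by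
  refine ⟨by simp [J, zB e ha.2 hb.1], lm hb.1 _, rz ha.2 _⟩

lemma a11_22 {a b : R} (ha : M11 e a) (hb' : M22 e b) : φ (a + b) = φ a + φ b := by
  refine crit hb fun T hT => M_zero (e := e) ?_ ?_
  · exact U22 F fun c hc => stepl hb hJ hT c (z1122 ha hc)
  · exact Ue F (stepr hb hJ hT e (z2211 hb' (Me F)))

lemma a12_21 {a b : R} (ha : M12 e a) (hb' : M21 e b) : φ (a + b) = φ a + φ b := by
  refine crit hb fun T hT => Uoff F ?_ ?_ ?_
  · have : J T e = T := by
      apply hb.1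
      rw [key hb hJ hT, Je12 ha, Je21 hb', hT]
    rw [J_sub, this, J_add, Je12 ha, Je21 hb']
  · exact fun c hc => stepl hb hJ hT c (z12 ha hc)
  · exact fun c hc => stepr hb hJ hT c (z21 hb' hc)

lemma a22_12 {a b : R} (ha : M22 e a) (hb' : M12 e b) : φ (a + b) = φ a + φ b := by
  refine crit hb fun T hT => U222 F ?_ ?_
  · exact Ue F (stepl hb hJ hT e (z2211 ha (Me F)))
  · exact fun c hc => stepr hb hJ hT c (z12 hb' hc)

lemma a22_21 {a b : R} (ha : M22 e a) (hb' : M21 e b) : φ (a + b) = φ a + φ b := by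
  refine crit hb fun T hT => U222' F ?_ ?_
  · exact Ue F (stepl hb hJ hT e (z2211 ha (Me F)))
  · exact fun c hc => stepr hb hJ hT c (z21 hb' hc)

lemma a11_12 {a b : R} (ha : M11 e a) (hb' : M12 e b) : φ (a + b) = φ a + φ b := by
  refine crit hb fun T hT => U11 F ?_ ?_
  · exact U22 F fun c hc => stepl hb hJ hT c (z1122 ha hc)
  · exact fun c hc => stepr hb hJ hT c (z12 hb' hc)

lemma a11_21 {a b : R} (ha : M11 e a) (hb' : M21 e b) : φ (a + b) = φ a + φ b := by
  refine crit hb fun T hT => U11' F ?_ ?_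
  · exact U22 F fun c hc => stepl hb hJ hT c (z1122 ha hc)
  · exact fun c hc => stepr hb hJ hT c (z21 hb' hc)

lemma a11_off {a b c : R} (ha : M11 e a) (hb' : M12 e b) (hc' : M21 e c) :
    φ (a + (b + c)) = φ a + φ (b + c) := by
  refine crit hb fun T hT => ?_
  have hD : M11 e (T - (a + (b + c))) :=
    U22 F fun c hc => stepl hb hJ hT c (z1122 ha hc)
  refine F.g12 _ hD.2 fun u hu => F.g22 _ (rz hu.2 _) fun v hv => ?_
  have h1 := key hb hJ hT u
  rw [J_add b, z12 hb' hu, zero_add] at h1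
  have h2 : J (J (T - (a + (b + c))) u) v = 0 := by
    have : J (J (T - (a + (b + c))) u) v = J (J T u - (J a u + J c u)) v := by
      simp only [J_sub, J_add, z12 hb' hu, J_zero]; abel
    rw [this]
    apply step hb hJ h1
    rw [(J1112 ha hu).1, (J1222 (J1112 ha hu).2 hv).1, add_comm, add_comm (φ _)]
    apply a22_12 F hb hJ _ (J1222 (J1112 ha hu).2 hv).2
    have k1 : J (J c u) v = (c * u) * v + v * (c * u) := by
      simp only [J, add_mul, mul_add]
      rw [mul_assoc u c v, zA e hc'.2 hv.1, ← mul_assoc v u c, zB e hv.2 hu.1]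
      simp
    rw [k1]
    constructor
    · simp [mul_add, mul_assoc, lz hc'.1, lz hv.1]
    · simp [add_mul, mul_assoc, hv.2, hu.2]
  rw [(J1112 hD hu).1, (J1222 (J1112 hD hu).2 hv).1] at h2
  exact h2

lemma a22_off {a b c : R} (ha : M22 e a) (hb' : M12 e b) (hc' : M21 e c) :
    φ (a + (b + c)) = φ a + φ (b + c) := by
  refine crit hb fun T hT => ?_
  have hD : M22 e (T - (a + (b + c))) :=
    Ue F (stepl hb hJ hT e (z2211 ha (Me F)))
  refine F.g12' _ hD.1 fun u hu => ?_
  have h1 := key hb hJ hT u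
  rw [J_add b, z12 hb' hu, zero_add] at h1
  have h2 : J (J (T - (a + (b + c))) u) e = 0 := by
    have : J (J (T - (a + (b + c))) u) e = J (J T u - (J a u + J c u)) e := by
      simp only [J_sub, J_add, z12 hb' hu, J_zero]; abel
    rw [this]
    apply step hb hJ h1
    rw [(J2212 ha hu).1, (Je12 (J2212 ha hu).2), add_comm, add_comm (φ _)]
    apply a11_12 F hb hJ _ (J2212 ha hu).2
    have k1 : J (J c u) e = (u * c) + u * c := by
      simp only [J, add_mul, mul_add]
      simp [mul_assoc, hu.2, hc'.2, lz hc'.1, lm hu.1]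
    rw [k1]
    constructor
    · simp [mul_add, lm hu.1]
    · simp [add_mul, mul_assoc, hc'.2]
  rw [(J2212 hD hu).1, (Je12 (J2212 hD hu).2)] at h2
  exact h2

lemma a_all {a d b c : R} (ha : M11 e a) (hd : M22 e d) (hb' : M12 e b) (hc' : M21 e c) :
    φ ((a + d) + (b + c)) = φ a + φ d + (φ b + φ c) := by
  rw [← a11_22 F hb hJ ha hd, ← a12_21 F hb hJ hb' hc']
  refine crit hb fun T hT => M_zero (e := e) ?_ ?_
  · refine U22 F fun x hx => step hb hJ hT x ?_
    rw [J_add a, z1122 ha hx, zero_add, J_add b, (J1222 hb' hx).1, (J2122 hc' hx).1]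
    refine a22_off F hb hJ ?_ (J1222 hb' hx).2 (J2122 hc' hx).2
    constructor
    · simp [J, mul_add, lz hd.1, lz hx.1]
    · simp [J, add_mul, rz hd.2, rz hx.2]
  · refine Ue F (step hb hJ hT e ?_)
    rw [J_add a, z2211 hd (Me F), add_zero, J_add b, Je12 hb', Je21 hc']
    refine a11_off F hb hJ ?_ hb' hc'
    constructor
    · simp [J, mul_add, ha.1, ha.2]
    · simp [J, add_mul, ha.1, ha.2]

lemma a12 {a b : R} (ha : M12 e a) (hb' : M12 e b) : φ (a + b) = φ a + φ b := by
  refine crit hb fun T hT => U11 F ?_ ?_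
  · refine U22 F fun c hc => step hb hJ hT c ?_
    have k : ∀ {u v : R}, M12 e u → M12 e v → φ (u * c + v) = φ (u * c) + φ v := by
      intro u v hu hv
      have h1 : J (e + u) (c + v) = u * c + v := by
        simp only [J_add, J_add', z1122 (Me F) hc, z12 hu hv, (J1222 hu hc).1]
        rw [(J1112 (Me F) hv).1, hv.1]; abel
      rw [← h1, hJ, a11_12 F hb hJ (Me F) hu, a22_12 F hb hJ hc hv]
      simp only [J_add, J_add']
      simp only [← hJ]
      rw [z1122 (Me F) hc, z12 hu hv, (J1222 hu hc).1, (J1112 (Me F) hv).1, hv.1, phi0 hb hJ]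
      abel
    rw [(J1222 ha hc).1, (J1222 hb' hc).1]
    exact k ha (J1222 hb' hc).2
  · exact fun c hc => stepl hb hJ hT c (z12 ha hc)

lemma a21 {a b : R} (ha : M21 e a) (hb' : M21 e b) : φ (a + b) = φ a + φ b := by
  refine crit hb fun T hT => U11' F ?_ ?_
  · refine U22 F fun c hc => step hb hJ hT c ?_
    have k : ∀ {u v : R}, M21 e u → M21 e v → φ (c * u + v) = φ (c * u) + φ v := by
      intro u v hu hv
      have h0 : J e v = v := by simp [J, hv.1, hv.2]
      have h1 : J (e + u) (c + v) = c * u + v := by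
        simp only [J_add, J_add', z1122 (Me F) hc, z21 hu hv, (J2122 hu hc).1]
        rw [h0]; abel
      rw [← h1, hJ, a11_21 F hb hJ (Me F) hu, a22_21 F hb hJ hc hv]
      simp only [J_add, J_add']
      simp only [← hJ]
      rw [z1122 (Me F) hc, z21 hu hv, (J2122 hu hc).1, h0, phi0 hb hJ]
      abel
    rw [(J2122 ha hc).1, (J2122 hb' hc).1]
    exact k ha (J2122 hb' hc).2
  · exact fun c hc => stepl hb hJ hT c (z21 ha hc)

lemma a11 {a b : R} (ha : M11 e a) (hb' : M11 e b) : φ (a + b) = φ a + φ b := by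
  refine crit hb fun T hT => U11 F ?_ ?_
  · exact U22 F fun c hc => stepl hb hJ hT c (z1122 ha hc)
  · refine fun c hc => step hb hJ hT c ?_
    rw [(J1112 ha hc).1, (J1112 hb' hc).1]
    exact a12 F hb hJ (J1112 ha hc).2 (J1112 hb' hc).2

lemma a22 {a b : R} (ha : M22 e a) (hb' : M22 e b) : φ (a + b) = φ a + φ b := by
  refine crit hb fun T hT => U222 F ?_ ?_
  · exact Ue F (stepl hb hJ hT e (z2211 ha (Me F)))
  · refine fun c hc => step hb hJ hT c ?_
    rw [(J2212 ha hc).1, (J2212 hb' hc).1]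
    exact a12 F hb hJ (J2212 ha hc).2 (J2212 hb' hc).2

omit hb hJ in
lemma decomp (T : R) : ∃ a d b c, M11 e a ∧ M22 e d ∧ M12 e b ∧ M21 e c ∧
    T = (a + d) + (b + c) := by
  have he := F.he
  refine ⟨e * T * e, T - e * T - T * e + e * T * e, e * T - e * T * e, T * e - e * T * e,
    ⟨?_, ?_⟩, ⟨?_, ?_⟩, ⟨?_, ?_⟩, ⟨?_, ?_⟩, by abel⟩
  all_goals simp [mul_sub, mul_add, sub_mul, add_mul, mul_assoc, he, lm he]

theorem additive (x y : R) : φ (x + y) = φ x + φ y := by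
  obtain ⟨a, d, b, c, ha, hd, hb1, hc, rfl⟩ := decomp F x
  obtain ⟨a', d', b', c', ha', hd', hb', hc', rfl⟩ := decomp F y
  have h : a + d + (b + c) + (a' + d' + (b' + c')) =
    ((a + a') + (d + d')) + ((b + b') + (c + c')) := by abel
  rw [h, a_all F hb hJ, a_all F hb hJ ha hd hb1 hc, a_all F hb hJ ha' hd' hb' hc',
    a11 F hb hJ ha ha', a22 F hb hJ hd hd', a12 F hb hJ hb1 hb', a21 F hb hJ hc hc']
  · abel
  · constructor
    · rw [mul_add, ha.1, ha'.1]
    · rw [add_mul, ha.2, ha'.2]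
  · constructor
    · rw [mul_add, hd.1, hd'.1, add_zero]
    · rw [add_mul, hd.2, hd'.2, add_zero]
  · constructor
    · rw [mul_add, hb1.1, hb'.1]
    · rw [add_mul, hb1.2, hb'.2, add_zero]
  · constructor
    · rw [mul_add, hc.1, hc'.1, add_zero]
    · rw [add_mul, hc.2, hc'.2]

end abs

section conc
open ContinuousLinearMap InnerProductSpace
open scoped ComplexOrder

lemma fin_rankOne {H : Type*} [NormedAddCommGroup H] [InnerProductSpace ℂ H] (x y : H) :
    FiniteDimensional ℂ (LinearMap.range ((rankOne ℂ x y : H →L[ℂ] H) : H →ₗ[ℂ] H)) := by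
  apply Submodule.finiteDimensional_of_le (S₂ := ℂ ∙ x)
  rintro _ ⟨w, rfl⟩
  exact Submodule.mem_span_singleton.2 ⟨_, rfl⟩

variable {H K : Type*} [NormedAddCommGroup H] [InnerProductSpace ℂ H] [CompleteSpace H]
    [NormedAddCommGroup K] [InnerProductSpace ℂ K] [CompleteSpace K]

lemma exists_orth (hH : 1 < Module.rank ℂ H) : ∃ x y : H, ‖x‖ = 1 ∧ y ≠ 0 ∧ inner ℂ x y = 0 := by
  have : Nontrivial H := by
    rw [← rank_pos_iff_nontrivial (R := ℂ)]
    exact lt_trans zero_lt_one hH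
  obtain ⟨v, hv⟩ := exists_ne (0 : H)
  have hx : ‖((‖v‖⁻¹ : ℝ) : ℂ) • v‖ = 1 := by
    simp [norm_smul, hv]
  set x : H := ((‖v‖⁻¹ : ℝ) : ℂ) • v
  have : ∃ w : H, ∀ r : ℂ, r • x ≠ w := by
    by_contra! h
    exact absurd (rank_le_one_iff.2 ⟨x, h⟩) (not_le.2 hH)
  obtain ⟨w, hw⟩ := this
  refine ⟨x, w - (inner ℂ x w : ℂ) • x, hx, fun h => hw _ (sub_eq_zero.1 h).symm, ?_⟩
  simp [inner_sub_right, inner_smul_right, inner_self_eq_norm_sq_to_K, hx]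

lemma faith (𝒜 : NonUnitalSubalgebra ℂ (H →L[ℂ] H))
    (h𝒜 : ∀ T : H →L[ℂ] H, FiniteDimensional ℂ (LinearMap.range (T : H →ₗ[ℂ] H)) → T ∈ 𝒜)
    (x y : H) (hx : ‖x‖ = 1) (hy : y ≠ 0) (hxy : inner ℂ x y = 0) :
    Faith (⟨rankOne ℂ x x, h𝒜 _ (fin_rankOne x x)⟩ : 𝒜) := by
  have hx0 : x ≠ 0 := by rintro rfl; simp at hx
  have hyx : inner ℂ y x = 0 := inner_eq_zero_symm.1 hxy
  have hxx : inner ℂ x x = (1 : ℂ) := by simp [inner_self_eq_norm_sq_to_K, hx]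
  set e : 𝒜 := ⟨rankOne ℂ x x, h𝒜 _ (fin_rankOne x x)⟩ with he
  have ev : ∀ {a b : 𝒜}, a = b → ∀ w, (a : H →L[ℂ] H) w = (b : H →L[ℂ] H) w := by
    rintro a _ rfl w; rfl
  have ext : ∀ {a b : 𝒜}, (∀ w, (a : H →L[ℂ] H) w = (b : H →L[ℂ] H) w) → a = b :=
    fun h => Subtype.ext (ContinuousLinearMap.ext h)
  have m12 : ∀ u, inner ℂ x u = 0 → M12 e (⟨rankOne ℂ x u, h𝒜 _ (fin_rankOne x u)⟩ : 𝒜) := by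
    intro u hu
    have hu' := inner_eq_zero_symm.1 hu
    constructor <;> refine ext fun w => ?_ <;> simp [e, inner_smul_right, hx, hu']
  have m21 : ∀ u, inner ℂ x u = 0 → M21 e (⟨rankOne ℂ u x, h𝒜 _ (fin_rankOne u x)⟩ : 𝒜) := by
    intro u hu
    constructor <;> refine ext fun w => ?_ <;> simp [e, inner_smul_right, hx, hu]
  have m22 : ∀ u, inner ℂ x u = 0 → M22 e (⟨rankOne ℂ u u, h𝒜 _ (fin_rankOne u u)⟩ : 𝒜) := by
    intro u hu
    have hu' := inner_eq_zero_symm.1 hu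
    constructor <;> refine ext fun w => ?_ <;> simp [e, inner_smul_right, hu, hu']
  have ze : ∀ z : 𝒜, z * e = 0 → (z : H →L[ℂ] H) x = 0 := by
    intro z hz
    simpa [e, hx0] using ev hz x
  have ez : ∀ z : 𝒜, e * z = 0 → ∀ w, inner ℂ x ((z : H →L[ℂ] H) w) = 0 := by
    intro z hz w
    simpa [e, hx0] using ev hz w
  have zz : ∀ z : 𝒜, z * e = 0 → (∀ u, inner ℂ x u = 0 → (z : H →L[ℂ] H) u = 0) → z = 0 := by
    intro z hz h
    refine ext fun w => ?_
    have := h (w - (inner ℂ x w : ℂ) • x) (by simp [inner_sub_right, inner_smul_right, hx])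
    simpa [ze z hz] using this
  constructor
  · refine ext fun w => ?_; simp [e, inner_smul_right, hx]
  · intro z hz
    refine ext fun w => ?_
    have := ev hz w
    simpa [← two_smul ℂ] using this
  · intro z hz h
    refine zz z hz.2 fun u hu => ?_
    by_cases hu0 : u = 0
    · simp [hu0]
    have huu : (inner ℂ u u : ℂ) ≠ 0 := inner_self_ne_zero.2 hu0
    have h1 : (inner ℂ u u : ℂ) • (z : H →L[ℂ] H) u
        + (inner ℂ u ((z : H →L[ℂ] H) u) : ℂ) • u = 0 := by
      rw [← map_smul]
      exact ev (h _ (m22 u hu)) u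
    have h2 := congrArg (fun v => (inner ℂ u v : ℂ)) h1
    simp only [inner_add_right, inner_smul_right, inner_zero_right] at h2
    have h3 : (inner ℂ u ((z : H →L[ℂ] H) u) : ℂ) = 0 := by
      have : (2 * inner ℂ u u : ℂ) * inner ℂ u ((z : H →L[ℂ] H) u) = 0 := by
        linear_combination h2
      rcases mul_eq_zero.1 this with h | h
      · exact absurd h (mul_ne_zero two_ne_zero huu)
      · exact h
    rw [h3, zero_smul, add_zero] at h1
    exact (smul_eq_zero.1 h1).resolve_left huu
  · intro z hz h
    have h1 := ev (h _ (m12 y hxy)) y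
    have : (z : H →L[ℂ] H) x = 0 := by simpa [hy] using h1
    rw [← hz]
    refine ext fun w => ?_
    simp [e, this]
  · intro z hz h
    refine ext fun w => ?_
    have := ev (h _ (m12 _ (ez z hz w))) w
    simpa [hx0] using this
  · intro z hz h
    have h1 : ∀ w, inner ℂ x ((z : H →L[ℂ] H) w) = 0 := by
      intro w
      simpa [hy] using ev (h _ (m21 y hxy)) w
    rw [← hz]
    refine ext fun w => ?_
    simp [e, h1]
  · intro z hz h
    refine zz z hz fun u hu => ?_
    simpa [hx0] using ev (h _ (m21 u hu)) x
  · intro z hz h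
    refine zz z hz fun u hu => ?_
    by_cases hu0 : u = 0
    · simp [hu0]
    simpa [hu0] using ev (h _ (m22 u hu)) u
  · intro z hz h
    refine ext fun w => ?_
    simpa using ev (h _ (m22 _ (ez z hz w))) w

lemma half {V : Type*} [AddCommGroup V] [Module ℂ V] {a b : V} (h : a + a = b + b) : a = b := by
  rw [← two_smul ℂ, ← two_smul ℂ b] at h
  exact smul_right_injective V (two_ne_zero (α := ℂ)) h

lemma corner {R S : Type*} [NonUnitalRing R] [NonUnitalRing S] [Module ℂ S]
    {φ : R → S} (hadd : ∀ a b, φ (a + b) = φ a + φ b)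
    (hJ : ∀ a b, φ (J a b) = J (φ a) (φ b)) {p : R} (hp : p * p = p)
    (hq : φ p * φ p = φ p) (a : R) : φ (p * a * p) = φ p * φ a * φ p := by
  apply half
  have id : ∀ (p a : R), p * p = p →
      J p (J p a) = (p * a * p + p * a * p) + J p a := by
    intro p a hp
    have h1 : p * (p * a) = p * a := by rw [← mul_assoc, hp]
    have h2 : a * p * p = a * p := by rw [mul_assoc, hp]
    simp only [J, mul_add, add_mul, h1, h2, ← mul_assoc, hp]; abel
  have id' : ∀ (p a : S), p * p = p →
      J p (J p a) = (p * a * p + p * a * p) + J p a := by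
    intro p a hp
    have h1 : p * (p * a) = p * a := by rw [← mul_assoc, hp]
    have h2 : a * p * p = a * p := by rw [mul_assoc, hp]
    simp only [J, mul_add, add_mul, h1, h2, ← mul_assoc, hp]; abel
  have h := hJ p (J p a)
  rw [id p a hp, hJ p a, id' _ _ hq, hadd, hadd, hJ] at h
  exact add_right_cancel h

lemma sq {R S : Type*} [NonUnitalRing R] [NonUnitalRing S] [Module ℂ S]
    {φ : R → S} (hadd : ∀ a b, φ (a + b) = φ a + φ b)
    (hJ : ∀ a b, φ (J a b) = J (φ a) (φ b)) (p : R) : φ (p * p) = φ p * φ p := by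
  apply half
  rw [← hadd]
  exact hJ p p

set_option maxHeartbeats 1000000 in
lemma pos (𝒜 : NonUnitalSubalgebra ℂ (H →L[ℂ] H)) (ℬ : NonUnitalSubalgebra ℂ (K →L[ℂ] K))
    (h𝒜 : ∀ T : H →L[ℂ] H, FiniteDimensional ℂ (LinearMap.range (T : H →ₗ[ℂ] H)) → T ∈ 𝒜)
    (hℬ : ∀ S : K →L[ℂ] K, FiniteDimensional ℂ (LinearMap.range (S : K →ₗ[ℂ] K)) → S ∈ ℬ)
    (φ : 𝒜 → ℬ) (hbij : Function.Bijective φ)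
    (hstar : ∀ A B : 𝒜, (B : H →L[ℂ] H) = adjoint (A : H →L[ℂ] H) →
      (φ B : K →L[ℂ] K) = adjoint (φ A : K →L[ℂ] K))
    (hstar' : ∀ A : 𝒜, adjoint (φ A : K →L[ℂ] K) = φ A → adjoint (A : H →L[ℂ] H) = A)
    (hadd : ∀ a b, φ (a + b) = φ a + φ b)
    (hJ : ∀ a b, φ (J a b) = J (φ a) (φ b)) (A : 𝒜)
    (hA : ∀ x : H, (0 : ℂ) ≤ (inner ℂ ((A : H →L[ℂ] H) x) x : ℂ)) (y : K) :
    (0 : ℂ) ≤ (inner ℂ ((φ A : K →L[ℂ] K) y) y : ℂ) := by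
  have h0 : φ 0 = 0 := phi0 hbij hJ
  by_cases hy0 : y = 0
  · simp [hy0]
  suffices H : ∀ u : K, ‖u‖ = 1 → (0 : ℂ) ≤ (inner ℂ ((φ A : K →L[ℂ] K) u) u : ℂ) by
    have hu : ‖((‖y‖⁻¹ : ℝ) : ℂ) • y‖ = 1 := by
      simp [norm_smul, hy0]
    have hyu : y = ((‖y‖ : ℝ) : ℂ) • (((‖y‖⁻¹ : ℝ) : ℂ) • y) := by
      rw [smul_smul, ← Complex.ofReal_mul, mul_inv_cancel₀ (norm_ne_zero_iff.2 hy0)]; simp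
    have h1 := H _ hu
    rw [hyu, map_smul, inner_smul_left, inner_smul_right, Complex.conj_ofReal, ← mul_assoc,
      ← Complex.ofReal_mul]
    exact mul_nonneg (Complex.zero_le_real.2 (by positivity)) h1
  clear hy0 y
  intro u hu
  have huu : inner ℂ u u = (1 : ℂ) := by simp [inner_self_eq_norm_sq_to_K, hu]
  obtain ⟨p, hp⟩ := hbij.2 (⟨rankOne ℂ u u, hℬ _ (fin_rankOne u u)⟩ : ℬ)
  have hpc : (φ p : K →L[ℂ] K) = rankOne ℂ u u := by rw [hp]
  have hq : φ p * φ p = φ p := by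
    refine Subtype.ext (ContinuousLinearMap.ext fun w => ?_)
    simp [hpc, inner_smul_right, hu]
  have hpp : p * p = p := hbij.1 (by rw [sq hadd hJ, hq])
  have hps : adjoint (p : H →L[ℂ] H) = p := hstar' p (by rw [hpc]; simp)
  have hcor : ∀ a : 𝒜, φ (p * a * p) = φ p * φ a * φ p := corner hadd hJ hpp hq
  have hp0 : p ≠ 0 := by
    rintro rfl
    have := congrArg (fun T : K →L[ℂ] K => T u) hpc
    rw [h0] at this
    have hu0 : u ≠ 0 := by rintro rfl; simp at hu
    simp [hu, hu0.symm] at this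
  have : ∃ v, (p : H →L[ℂ] H) v ≠ 0 := by
    by_contra! h
    exact hp0 (Subtype.ext (ContinuousLinearMap.ext h))
  obtain ⟨v, hv⟩ := this
  obtain ⟨x, hx, hpx⟩ : ∃ x : H, ‖x‖ = 1 ∧ (p : H →L[ℂ] H) x = x := by
    refine ⟨((‖(p : H →L[ℂ] H) v‖⁻¹ : ℝ) : ℂ) • (p : H →L[ℂ] H) v, by simp [norm_smul, hv], ?_⟩
    rw [map_smul]
    congr 1
    exact congrArg (fun T : 𝒜 => (T : H →L[ℂ] H) v) hpp
  have hxx : inner ℂ x x = (1 : ℂ) := by simp [inner_self_eq_norm_sq_to_K, hx]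
  have hsym : ∀ w, inner ℂ x ((p : H →L[ℂ] H) w) = (inner ℂ x w : ℂ) := by
    intro w
    rw [← adjoint_inner_left, hps, hpx]
  set p' : 𝒜 := ⟨rankOne ℂ x x, h𝒜 _ (fin_rankOne x x)⟩ with hp'
  have hp'p' : p' * p' = p' := by
    refine Subtype.ext (ContinuousLinearMap.ext fun w => ?_)
    simp [p', inner_smul_right, hx]
  have hp'p : p * p' * p = p' := by
    refine Subtype.ext (ContinuousLinearMap.ext fun w => ?_)
    simp [p', hsym, hpx]
  have hqcor : ∀ b : ℬ, ((φ p * b * φ p : ℬ) : K →L[ℂ] K)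
      = (inner ℂ u ((b : K →L[ℂ] K) u) : ℂ) • rankOne ℂ u u := by
    intro b
    refine ContinuousLinearMap.ext fun w => ?_
    simp [hpc, inner_smul_right, smul_smul, mul_comm]
  have hpeq : p' = p := by
    have h1 : φ p' = φ p * φ p' * φ p := by rw [← hcor, hp'p]
    have h2 : φ p' * φ p' = φ p' := by rw [← sq hadd hJ, hp'p']
    have h3 : (φ p' : K →L[ℂ] K) = _ := (congrArg Subtype.val h1).trans (hqcor _)
    generalize (inner ℂ u ((φ p' : K →L[ℂ] K) u) : ℂ) = l at h3
    have h4 := congrArg (fun T : ℬ => (inner ℂ u ((T : K →L[ℂ] K) u) : ℂ)) h2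
    have h4' : l * l = l := by
      simpa only [NonUnitalSubalgebra.coe_mul, h3, smul_mul_smul_comm, _root_.smul_apply,
        ContinuousLinearMap.mul_def, comp_apply, ContinuousLinearMap.comp_apply, rankOne_apply,
        inner_smul_right, huu, mul_one, one_smul] using h4
    have h5 : l = 0 ∨ l = 1 := by
      have : l * (l - 1) = 0 := by linear_combination h4'
      rcases mul_eq_zero.1 this with h | h
      · exact Or.inl h
      · exact Or.inr (sub_eq_zero.1 h)
    rcases h5 with rfl | rfl
    · exfalso
      have : p' = 0 := hbij.1 (by rw [h0]; exact Subtype.ext (by simpa using h3))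
      have := congrArg (fun T : 𝒜 => (T : H →L[ℂ] H) x) this
      have hx0 : x ≠ 0 := by rintro rfl; simp at hx
      simp [p', hx, hx0] at this
    · exact hbij.1 (Subtype.ext (by rw [h3, hpc, one_smul]))
  have hpc' : (p : H →L[ℂ] H) = rankOne ℂ x x := by rw [← hpeq]
  obtain ⟨r, hr, hrA⟩ : ∃ r : ℝ, 0 ≤ r ∧ (inner ℂ x ((A : H →L[ℂ] H) x) : ℂ) = r := by
    have h1 := hA x
    rw [Complex.le_def] at h1
    refine ⟨(inner ℂ ((A : H →L[ℂ] H) x) x : ℂ).re, h1.1, ?_⟩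
    rw [← inner_conj_symm]
    apply Complex.ext
    · rw [Complex.conj_re, Complex.ofReal_re]
    · rw [Complex.conj_im, Complex.ofReal_im, ← h1.2, Complex.zero_im, neg_zero]
  set b : 𝒜 := ((Real.sqrt r : ℝ) : ℂ) • p with hb
  have hbs : adjoint (φ b : K →L[ℂ] K) = φ b := by
    refine (hstar b b ?_).symm
    simp only [b, NonUnitalSubalgebra.coe_smul, map_smulₛₗ, hps, Complex.conj_ofReal]
  have hbb : b * b = p * A * p := by
    refine Subtype.ext (ContinuousLinearMap.ext fun w => ?_)
    have hrr : ((Real.sqrt r : ℝ) : ℂ) * ((Real.sqrt r : ℝ) : ℂ) = r := by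
      rw [← Complex.ofReal_mul, Real.mul_self_sqrt hr]
    simp only [b, hpc', NonUnitalSubalgebra.coe_mul, NonUnitalSubalgebra.coe_smul,
      ContinuousLinearMap.mul_def, ContinuousLinearMap.comp_apply, _root_.smul_apply, rankOne_apply, map_smul,
      inner_smul_right, hxx, hrA, smul_smul]
    congr 1
    linear_combination (inner ℂ x w : ℂ) * hrr
  have h1 : φ b * φ b = φ p * φ A * φ p := by rw [← sq hadd hJ, hbb, hcor]
  have h2 := congrArg (fun T : ℬ => (inner ℂ ((T : K →L[ℂ] K) u) u : ℂ)) h1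
  have h3 : (inner ℂ ((φ A : K →L[ℂ] K) u) u : ℂ)
      = inner ℂ ((φ b : K →L[ℂ] K) u) ((φ b : K →L[ℂ] K) u) := by
    simp only [hqcor] at h2
    simp [inner_smul_left, hu] at h2
    rw [← h2, ← adjoint_inner_right, hbs]
  rw [h3, inner_self_eq_norm_sq_to_K]
  norm_cast
  positivity

end conc
end JMap


open scoped ComplexOrder

/-- A bijective `*`-preserving map satisfying `φ(AB+BA) = φ(A)φ(B)+φ(B)φ(A)` between
standard operator algebras (closed under adjoints) on complex Hilbert spaces,
`dim H > 1`, preserves positivity in both directions. -/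
theorem jordan_star_map_preserves_positivity
    {H K : Type*} [NormedAddCommGroup H] [InnerProductSpace ℂ H] [CompleteSpace H]
    [NormedAddCommGroup K] [InnerProductSpace ℂ K] [CompleteSpace K]
    (hH : 1 < Module.rank ℂ H)
    (𝒜 : NonUnitalSubalgebra ℂ (H →L[ℂ] H)) (ℬ : NonUnitalSubalgebra ℂ (K →L[ℂ] K))
    (h𝒜 : ∀ T : H →L[ℂ] H, FiniteDimensional ℂ (LinearMap.range (T : H →ₗ[ℂ] H)) → T ∈ 𝒜)
    (hℬ : ∀ S : K →L[ℂ] K, FiniteDimensional ℂ (LinearMap.range (S : K →ₗ[ℂ] K)) → S ∈ ℬ)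
    (h𝒜star : ∀ T ∈ 𝒜, ContinuousLinearMap.adjoint T ∈ 𝒜)
    (hℬstar : ∀ S ∈ ℬ, ContinuousLinearMap.adjoint S ∈ ℬ)
    (φ : 𝒜 → ℬ) (hbij : Function.Bijective φ)
    (hstar : ∀ A : 𝒜,
      φ ⟨ContinuousLinearMap.adjoint (A : H →L[ℂ] H), h𝒜star _ A.2⟩
        = ⟨ContinuousLinearMap.adjoint ((φ A : K →L[ℂ] K)), hℬstar _ (φ A).2⟩)
    (hJ : ∀ A B : 𝒜, φ (A * B + B * A) = φ A * φ B + φ B * φ A) :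
    ∀ A : 𝒜, (∀ x : H, 0 ≤ (inner ℂ ((A : H →L[ℂ] H) x) x : ℂ)) ↔
      (∀ y : K, 0 ≤ (inner ℂ ((φ A : K →L[ℂ] K) y) y : ℂ)) := by
  intro A
  obtain ⟨x, y, hx, hy, hxy⟩ := JMap.exists_orth hH
  have hJ' : ∀ a b, φ (JMap.J a b) = JMap.J (φ a) (φ b) := hJ
  have hadd := JMap.additive (JMap.faith 𝒜 h𝒜 x y hx hy hxy) hbij hJ'
  have st : ∀ A B : 𝒜, (B : H →L[ℂ] H) = ContinuousLinearMap.adjoint (A : H →L[ℂ] H) →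
      (φ B : K →L[ℂ] K) = ContinuousLinearMap.adjoint (φ A : K →L[ℂ] K) := by
    intro A B h
    have h1 : B = ⟨_, h𝒜star _ A.2⟩ := Subtype.ext h
    rw [h1, hstar]
  have st' : ∀ A B : 𝒜, (φ B : K →L[ℂ] K) = ContinuousLinearMap.adjoint (φ A : K →L[ℂ] K) →
      (B : H →L[ℂ] H) = ContinuousLinearMap.adjoint (A : H →L[ℂ] H) := by
    intro A B h
    have h1 : B = ⟨_, h𝒜star _ A.2⟩ := hbij.1 (by rw [hstar]; exact Subtype.ext h)
    rw [h1]
  constructor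
  · intro hA
    exact JMap.pos 𝒜 ℬ h𝒜 hℬ φ hbij st (fun A h => (st' A A h.symm).symm) hadd hJ' A hA
  · intro hA
    let E := Equiv.ofBijective φ hbij
    have e1 : ∀ b, φ (E.symm b) = b := E.apply_symm_apply
    have h := JMap.pos ℬ 𝒜 hℬ h𝒜 E.symm E.symm.bijective
      (fun B C h => st' _ _ (by rw [e1, e1, h]))
      (fun B h => by
        have := st _ _ h.symm
        rw [e1] at this
        exact this.symm)
      (fun a b => hbij.1 (by rw [hadd, e1, e1, e1]))
      (fun a b => hbij.1 (by rw [hJ', e1, e1, e1])) (φ A) hA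
    have e2 : E.symm (φ A) = A := E.symm_apply_apply A
    rwa [e2] at h
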